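/- Let r = 1 and let f be a nonzero binary form of degree d over K with 2·sr(f) ≥ d + 2. Then S(f) is infinite: there are infinitely many pairwise non-identified decompositions of f. -/

import Mathlib

open MvPolynomial

/-- The degree-`d` power of (a representative linear form of) a point of `ℙ^r`,
regarded as a homogeneous polynomial of degree `d` in `x_0, …, x_r`. -/
noncomputable def powForm (K : Type) [Field K] (r d : ℕ)
    (p : Projectivization K (Fin (r + 1) → K)) : MvPolynomial (Fin (r + 1)) K :=
  (∑ i, MvPolynomial.C (p.rep i) * MvPolynomial.X i) ^ d

/-- The span of the `d`-th powers of the linear forms corresponding to a set of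
points of `ℙ^r`. -/
noncomputable def decompSpan (K : Type) [Field K] (r d : ℕ)
    (S : Set (Projectivization K (Fin (r + 1) → K))) :
    Submodule K (MvPolynomial (Fin (r + 1)) K) :=
  Submodule.span K (powForm K r d '' S)

/-- The symmetric rank of `f`. -/
noncomputable def symRank (K : Type) [Field K] (r d : ℕ)
    (f : MvPolynomial (Fin (r + 1)) K) : ℕ :=
  sInf {n | ∃ A : Finset (Projectivization K (Fin (r + 1) → K)),
    A.card = n ∧ f ∈ decompSpan K r d ↑A}

/-- `S(f)`: the set of decompositions of `f`, i.e. finite sets of points of `ℙ^r`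
computing the symmetric rank of `f`. -/
def decompSet (K : Type) [Field K] (r d : ℕ) (f : MvPolynomial (Fin (r + 1)) K) :
    Set (Finset (Projectivization K (Fin (r + 1) → K))) :=
  {A | f ∈ decompSpan K r d ↑A ∧ A.card = symRank K r d f}

/-- The points of `ℙ^r` lying on the hypersurface `Z(q)`. -/
def projZeros (K : Type) [Field K] (r : ℕ) (q : MvPolynomial (Fin (r + 1)) K) :
    Set (Projectivization K (Fin (r + 1) → K)) :=
  {p | MvPolynomial.eval p.rep q = 0}

/-- A line of `ℙ^r`. -/
def IsProjLine (K : Type) [Field K] (r : ℕ)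
    (L : Set (Projectivization K (Fin (r + 1) → K))) : Prop :=
  ∃ W : Submodule K (Fin (r + 1) → K), Module.finrank K W = 2 ∧
    L = {p | p.rep ∈ W}

/-- A smooth conic of `ℙ^r`. -/
def IsSmoothConic (K : Type) [Field K] (r : ℕ)
    (C : Set (Projectivization K (Fin (r + 1) → K))) : Prop :=
  ∃ u v w : Fin (r + 1) → K, LinearIndependent K ![u, v, w] ∧
    C = {p | ∃ s t : K, (s ≠ 0 ∨ t ≠ 0) ∧
      p.submodule = Submodule.span K {s ^ 2 • u + (s * t) • v + t ^ 2 • w}}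

namespace Polynomial

/-- In the pencil `g + t h`, with `g` a product of distinct linear factors and `h ≠ 0` of smaller
degree, all but finitely many members have no multiple root. -/
theorem finite_setOf_exists_multiple_root_pencil {K : Type*} [Field K] {s : Finset K}
    {h : K[X]} (h0 : h ≠ 0) (hdeg : h.degree < s.card) :
    {t : K | ∃ x, (∏ a ∈ s, (X - C a) + C t * h).eval x = 0 ∧
      (derivative (∏ a ∈ s, (X - C a) + C t * h)).eval x = 0}.Finite := by
  classical
  set g : K[X] := ∏ a ∈ s, (X - C a) with hg
  have hroot : ∀ x, g.eval x = 0 → x ∈ s := by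
    intro x hx
    simpa [hg, eval_prod, Finset.prod_eq_zero_iff, sub_eq_zero] using hx
  have hderiv : ∀ x ∈ s, (derivative g).eval x ≠ 0 := by
    intro x hx
    have hsep : g.Separable :=
      separable_prod_X_sub_C_iff'.2 fun _ _ _ _ hxy => hxy
    refine hsep.eval₂_derivative_ne_zero (RingHom.id K) ?_
    simpa [hg, eval₂_id, eval_prod, Finset.prod_eq_zero_iff, sub_eq_zero] using hx
  obtain ⟨a, ha, hha⟩ : ∃ a ∈ s, h.eval a ≠ 0 := by
    by_contra! H
    exact h0 (eq_zero_of_degree_lt_of_eval_finset_eq_zero s hdeg H)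
  have hga : g.eval a = 0 := by
    simpa [hg, eval_prod, Finset.prod_eq_zero_iff, sub_eq_zero] using ha
  set W : K[X] := g * derivative h - derivative g * h with hW
  have hW0 : W ≠ 0 := by
    intro H
    have : W.eval a = 0 := by simp [H]
    simp [hW, hga, hha, hderiv a ha] at this
  refine ((W.roots.toFinset.image fun x => -(g.eval x / h.eval x)) ∪
    (W.roots.toFinset.image fun x =>
      -((derivative g).eval x / (derivative h).eval x))).finite_toSet.subset ?_
  rintro t ⟨x, hx, hx'⟩
  simp only [eval_add, eval_mul, eval_C, derivative_add, derivative_mul, derivative_C, zero_mul,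
    zero_add] at hx hx'
  have hxW : x ∈ W.roots.toFinset := by
    rw [Multiset.mem_toFinset, mem_roots hW0, IsRoot.def, hW, eval_sub, eval_mul, eval_mul]
    linear_combination (derivative h).eval x * hx - h.eval x * hx'
  simp only [Finset.coe_union, Set.mem_union, Finset.mem_coe, Finset.mem_image]
  by_cases hhx : h.eval x = 0
  · right
    refine ⟨x, hxW, ?_⟩
    have hgx : g.eval x = 0 := by simpa [hhx] using hx
    have hne : (derivative h).eval x ≠ 0 := by
      intro H
      exact hderiv x (hroot x hgx) (by simpa [H] using hx')
    field_simp
    linear_combination -hx'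
  · left
    refine ⟨x, hxW, ?_⟩
    field_simp
    linear_combination -hx

/-- A linear functional on polynomials which vanishes on the multiples of degree at most `d` of
`∏ (X - b)`, with distinct `b`, is in degrees at most `d` a combination of evaluations
at the `b`. -/
theorem exists_moments_eq_of_forall_eq_zero {K : Type*} [Field K] {d : ℕ} (φ : K[X] →ₗ[K] K)
    (B : Finset K) (hφ : ∀ j < d + 1 - B.card, φ ((∏ b ∈ B, (X - C b)) * X ^ j) = 0) :
    ∃ c : K → K, ∀ k ≤ d, ∑ b ∈ B, c b * b ^ k = φ (X ^ k) := by
  classical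
  refine ⟨fun b => φ (Lagrange.basis B id b), fun k hk => ?_⟩
  set g : K[X] := ∏ b ∈ B, (X - C b) with hg
  have hmon : g.Monic := monic_prod_X_sub_C _ _
  have hdeg : g.natDegree = B.card := by simp [hg, natDegree_prod_of_monic, monic_X_sub_C]
  have hdeg' : g.degree = B.card := by rw [degree_eq_natDegree hmon.ne_zero, hdeg]
  have hdiv := modByMonic_add_div (X ^ k : K[X]) g
  have hq : φ (g * (X ^ k /ₘ g)) = 0 := by
    rcases eq_or_ne (X ^ k /ₘ g) 0 with h0 | h0
    · simp [h0]
    have hBk : B.card ≤ k := by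
      by_contra! H
      refine h0 ((divByMonic_eq_zero_iff hmon).2 ?_)
      rw [hdeg', degree_X_pow]
      exact_mod_cast H
    have hlt : (X ^ k /ₘ g).natDegree < d + 1 - B.card := by
      rw [natDegree_divByMonic _ hmon, natDegree_X_pow, hdeg]
      omega
    rw [as_sum_range' _ _ hlt, Finset.mul_sum, map_sum]
    refine Finset.sum_eq_zero fun j hj => ?_
    rw [← C_mul_X_pow_eq_monomial, mul_left_comm, ← smul_eq_C_mul, map_smul,
      hφ j (Finset.mem_range.1 hj), smul_zero]
  have hr : X ^ k %ₘ g = ∑ b ∈ B, C (b ^ k) * Lagrange.basis B id b := by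
    have h1 := Lagrange.eq_interpolate_of_eval_eq (s := B) (v := id) (f := X ^ k %ₘ g)
      (fun b => b ^ k) (fun _ _ _ _ h => h) (by
        rw [← hdeg']; exact degree_modByMonic_lt _ hmon) (by
        intro b hb
        have hgb : g.eval b = 0 := by
          simpa [hg, eval_prod, Finset.prod_eq_zero_iff, sub_eq_zero] using hb
        have := congrArg (eval b) hdiv
        simpa [hgb] using this)
    rw [h1, Lagrange.interpolate_apply]
  rw [← hdiv, map_add, hq, add_zero, hr, map_sum]
  refine Finset.sum_congr rfl fun b _ => ?_
  rw [← smul_eq_C_mul, map_smul, smul_eq_mul, mul_comm]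

/-- The first `d + 1` moments of a measure on `s` points of `K`, where `d + 2 ≤ 2 s`, are
the moments of measures supported on infinitely many other `s`-point sets. -/
theorem infinite_setOf_moments_eq {K : Type*} [Field K] [IsAlgClosed K] {d : ℕ}
    (s : Finset K) (c : K → K) (hs : d + 2 ≤ 2 * s.card) :
    {B : Finset K | B.card = s.card ∧
      ∃ c' : K → K, ∀ k ≤ d, ∑ b ∈ B, c' b * b ^ k = ∑ a ∈ s, c a * a ^ k}.Infinite := by
  classical
  set g : K[X] := ∏ a ∈ s, (X - C a) with hg
  let φ : K[X] →ₗ[K] K := ∑ a ∈ s, c a • leval a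
  have hφ : ∀ p, φ p = ∑ a ∈ s, c a * p.eval a := by
    intro p; simp [φ, LinearMap.sum_apply, leval]
  obtain ⟨h, h0, hdeg, hh⟩ : ∃ h : K[X], h ≠ 0 ∧ h.degree < s.card ∧
      ∀ j < d + 1 - s.card, φ (h * X ^ j) = 0 := by
    let ψ : degreeLT K s.card →ₗ[K] (Fin (d + 1 - s.card) → K) :=
      LinearMap.pi fun j => φ ∘ₗ LinearMap.mulRight K (X ^ (j : ℕ)) ∘ₗ (degreeLT K s.card).subtype
    have hfin : Module.finrank K (degreeLT K s.card) = s.card := by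
      rw [(degreeLTEquiv K s.card).finrank_eq, Module.finrank_fin_fun]
    have : FiniteDimensional K (degreeLT K s.card) :=
      (degreeLTEquiv K s.card).symm.finiteDimensional
    have hker : LinearMap.ker ψ ≠ ⊥ := by
      apply LinearMap.ker_ne_bot_of_finrank_lt
      rw [hfin, Module.finrank_fin_fun]
      omega
    obtain ⟨⟨h, hmem⟩, hψ, hne⟩ := Submodule.exists_mem_ne_zero_of_ne_bot hker
    refine ⟨h, fun H => hne (by simp [H]), mem_degreeLT.1 hmem, fun j hj => ?_⟩
    exact congrFun (LinearMap.mem_ker.1 hψ) ⟨j, hj⟩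
  have hgdeg : g.natDegree = s.card := by simp [hg, natDegree_prod_of_monic, monic_X_sub_C]
  have hgmon : g.Monic := monic_prod_X_sub_C _ _
  have hlt : ∀ t : K, (C t * h).degree < g.degree := by
    intro t
    rw [degree_eq_natDegree hgmon.ne_zero, hgdeg]
    refine lt_of_le_of_lt ?_ hdeg
    rw [← smul_eq_C_mul]
    exact degree_smul_le t h
  have hmon : ∀ t : K, (g + C t * h).Monic := fun t => hgmon.add_of_left (hlt t)
  have hnat : ∀ t : K, (g + C t * h).natDegree = s.card := fun t => by
    rw [natDegree_add_eq_left_of_degree_lt (hlt t), hgdeg]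
  have hgood := (finite_setOf_exists_multiple_root_pencil h0 hdeg).infinite_compl
  rw [← hg] at hgood
  set T : Set K := {t : K | ∃ x, (g + C t * h).eval x = 0 ∧
      (derivative (g + C t * h)).eval x = 0}ᶜ with hT
  have hnodup : ∀ t ∈ T, (g + C t * h).roots.Nodup := by
    intro t ht
    rw [Multiset.nodup_iff_count_le_one]
    intro x
    rw [count_roots]
    by_contra! H
    exact ht ⟨x, (one_lt_rootMultiplicity_iff_isRoot (hmon t).ne_zero).1 H⟩
  have hprod : ∀ t ∈ T, ∏ b ∈ (g + C t * h).roots.toFinset, (X - C b) = g + C t * h := by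
    intro t ht
    rw [Finset.prod, Multiset.toFinset_val, (hnodup t ht).dedup]
    exact ((IsAlgClosed.splits _).eq_prod_roots_of_monic (hmon t)).symm
  have hcard : ∀ t ∈ T, (g + C t * h).roots.toFinset.card = s.card := by
    intro t ht
    rw [Multiset.toFinset_card_of_nodup (hnodup t ht),
      ← (IsAlgClosed.splits (g + C t * h)).natDegree_eq_card_roots, hnat]
  refine (hgood.image (f := fun t => (g + C t * h).roots.toFinset) ?_).mono ?_
  · intro t ht u hu htu
    have h1 := hprod t ht
    rw [show (g + C t * h).roots.toFinset = (g + C u * h).roots.toFinset from htu,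
      hprod u hu] at h1
    exact (C_injective (mul_right_cancel₀ h0 (add_left_cancel h1))).symm
  · rintro _ ⟨t, ht, rfl⟩
    refine ⟨hcard t ht, ?_⟩
    obtain ⟨c', hc'⟩ := exists_moments_eq_of_forall_eq_zero (d := d) φ
      (g + C t * h).roots.toFinset (by
        intro j hj
        rw [hcard t ht] at hj
        have hgj : φ (g * X ^ j) = 0 := by
          rw [hφ]
          refine Finset.sum_eq_zero fun a ha => ?_
          have : g.eval a = 0 := by
            simpa [hg, eval_prod, Finset.prod_eq_zero_iff, sub_eq_zero] using ha
          simp [this]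
        rw [hprod t ht, add_mul, map_add, hgj, mul_assoc, ← smul_eq_C_mul, map_smul, hh j hj,
          smul_zero, add_zero])
    exact ⟨c', fun k hk => by rw [hc' k hk, hφ]; simp⟩

end Polynomial

/-- A combination of `d`-th powers `(M + a N) ^ d` depends only on the first `d + 1` moments. -/
theorem sum_smul_add_smul_pow_eq_of_moments_eq {K R : Type*} [Field K] [CommRing R] [Algebra K R]
    {d : ℕ} (M N : R) {s B : Finset K} {c c' : K → K}
    (h : ∀ k ≤ d, ∑ b ∈ B, c' b * b ^ k = ∑ a ∈ s, c a * a ^ k) :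
    ∑ b ∈ B, c' b • (b • N + M) ^ d = ∑ a ∈ s, c a • (a • N + M) ^ d := by
  have key : ∀ (t : Finset K) (e : K → K), ∑ a ∈ t, e a • (a • N + M) ^ d =
      ∑ k ∈ Finset.range (d + 1),
        (∑ a ∈ t, e a * a ^ k) • (N ^ k * M ^ (d - k) * (d.choose k : R)) := by
    intro t e
    simp only [add_pow, Finset.smul_sum, Finset.sum_smul]
    rw [Finset.sum_comm]
    refine Finset.sum_congr rfl fun k _ => Finset.sum_congr rfl fun a _ => ?_
    rw [smul_pow, smul_mul_assoc, smul_mul_assoc, smul_smul]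
  rw [key, key]
  refine Finset.sum_congr rfl fun k hk => ?_
  rw [h k (Nat.lt_succ_iff.1 (Finset.mem_range.1 hk))]

/-- The affine chart `a ↦ [a : 1 + m a]` of `ℙ^1`, which misses exactly the point `[1 : m]`. -/
noncomputable def affineChart {K : Type} [Field K] (m : K) :
    K ↪ Projectivization K (Fin (1 + 1) → K) where
  toFun a := Projectivization.mk K ![a, 1 + m * a] (by
    intro h
    have h0 : a = 0 := by simpa using congrFun h 0
    have h1 : 1 + m * a = 0 := by simpa using congrFun h 1
    simp [h0] at h1)
  inj' := by
    intro a b hab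
    obtain ⟨u, hu⟩ := (Projectivization.mk_eq_mk_iff' K _ _ _ _).1 hab
    have h0 : u * b = a := by simpa using congrFun hu 0
    have h1 : u * (1 + m * b) = 1 + m * a := by simpa using congrFun hu 1
    have hu1 : u = 1 := by linear_combination h1 - m * h0
    rw [← h0, hu1, one_mul]

theorem mem_range_affineChart {K : Type} [Field K] {m : K}
    {p : Projectivization K (Fin (1 + 1) → K)} (hp : m ≠ p.rep 1 / p.rep 0) :
    p ∈ Set.range (affineChart m) := by
  have hne : p.rep 1 - m * p.rep 0 ≠ 0 := by
    intro H
    by_cases h0 : p.rep 0 = 0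
    · refine p.rep_nonzero (funext fun i => ?_)
      fin_cases i
      · exact h0
      · simpa [h0] using H
    · apply hp
      field_simp
      linear_combination -H
  refine ⟨p.rep 0 / (p.rep 1 - m * p.rep 0), ?_⟩
  conv_rhs => rw [← p.mk_rep]
  refine (Projectivization.mk_eq_mk_iff' K _ _ _ _).2 ⟨(p.rep 1 - m * p.rep 0)⁻¹, ?_⟩
  funext i
  fin_cases i
  · simp [div_eq_inv_mul]
  · simp
    field_simp
    ring

theorem exists_powForm_affineChart {K : Type} [Field K] (m : K) (d : ℕ) (a : K) :
    ∃ u : K, u ≠ 0 ∧ powForm K 1 d (affineChart m a) =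
      u • (a • (X 0 + C m * X 1) + X 1 : MvPolynomial (Fin (1 + 1)) K) ^ d := by
  obtain ⟨u, hu⟩ := Projectivization.exists_smul_eq_mk_rep K ![a, 1 + m * a]
    (by
      intro h
      have h0 : a = 0 := by simpa using congrFun h 0
      have h1 : 1 + m * a = 0 := by simpa using congrFun h 1
      simp [h0] at h1)
  refine ⟨(u : K) ^ d, pow_ne_zero _ u.ne_zero, ?_⟩
  rw [← smul_pow]
  unfold powForm
  congr 1
  have hrep : (affineChart m a).rep = u • ![a, 1 + m * a] := hu.symm
  rw [hrep]
  simp [Fin.sum_univ_two, Units.smul_def, MvPolynomial.smul_eq_C_mul]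
  ring

theorem mem_decompSpan_map_affineChart_iff {K : Type} [Field K] (m : K) (d : ℕ) (B : Finset K)
    (f : MvPolynomial (Fin (1 + 1)) K) :
    f ∈ decompSpan K 1 d ↑(B.map (affineChart m)) ↔
      ∃ c : K → K, ∑ b ∈ B, c b • (b • (X 0 + C m * X 1) + X 1) ^ d = f := by
  choose u hu0 hu using exists_powForm_affineChart m d
  rw [decompSpan, Finset.coe_map, Set.image_image, Submodule.mem_span_image_finset_iff_exists_fun']
  constructor
  · rintro ⟨c, hc⟩
    refine ⟨fun b => c b * u b, ?_⟩
    rw [← hc]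
    refine Finset.sum_congr rfl fun b _ => ?_
    rw [hu, smul_smul]
  · rintro ⟨c, hc⟩
    refine ⟨fun b => c b * (u b)⁻¹, ?_⟩
    rw [← hc]
    refine Finset.sum_congr rfl fun b _ => ?_
    rw [hu, smul_smul, mul_assoc, inv_mul_cancel₀ (hu0 b), mul_one]

/-- a nonzero binary form `f` of degree `d` with `2 · sr(f) ≥ d + 2`
has infinitely many decompositions. -/
theorem stmt_7 {K : Type} [Field K] [IsAlgClosed K] [CharZero K]
    {d : ℕ} (hd : 1 ≤ d)
    {f : MvPolynomial (Fin (1 + 1)) K} (hf0 : f ≠ 0) (hfh : f.IsHomogeneous d)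
    (hsr : d + 2 ≤ 2 * symRank K 1 d f) :
    (decompSet K 1 d f).Infinite := by
  classical
  obtain ⟨A, hA, hfA⟩ : ∃ A : Finset (Projectivization K (Fin (1 + 1) → K)),
      A.card = symRank K 1 d f ∧ f ∈ decompSpan K 1 d ↑A := by
    refine Nat.sInf_mem (s := {n | ∃ A : Finset (Projectivization K (Fin (1 + 1) → K)),
      A.card = n ∧ f ∈ decompSpan K 1 d ↑A}) (Set.nonempty_iff_ne_empty.2 fun H => ?_)
    rw [symRank, H, Nat.sInf_empty] at hsr
    omega
  obtain ⟨m, hm⟩ := Infinite.exists_notMem_finset (A.image fun p => p.rep 1 / p.rep 0)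
  obtain ⟨s, rfl⟩ : ∃ s : Finset K, s.map (affineChart m) = A := by
    refine ⟨A.preimage (affineChart m) (affineChart m).injective.injOn, ?_⟩
    rw [Finset.map_eq_image, Finset.image_preimage, Finset.filter_true_of_mem]
    exact fun p hp => mem_range_affineChart fun H => hm (Finset.mem_image.2 ⟨p, hp, H.symm⟩)
  rw [Finset.card_map] at hA
  obtain ⟨c, hc⟩ := (mem_decompSpan_map_affineChart_iff m d s f).1 hfA
  refine ((Polynomial.infinite_setOf_moments_eq s c (hA ▸ hsr)).image
    (Finset.map_injective (affineChart m)).injOn).mono ?_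
  rintro _ ⟨B, ⟨hBcard, c', hc'⟩, rfl⟩
  refine ⟨(mem_decompSpan_map_affineChart_iff m d B f).2 ⟨c', ?_⟩, ?_⟩
  · rw [← hc]
    exact sum_smul_add_smul_pow_eq_of_moments_eq _ _ hc'
  · rw [Finset.card_map, hBcard, hA]
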